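/- Let g : ℝ → ℝ be of class C² satisfying (A1)–(A4), let p, F and the Stein solution f_z be as associated with g, and let W be a real random variable with E g²(W) < ∞. Then there is a constant C depending only on τ (from (A4)) and E g²(W) such that for all z ∈ ℝ: √(E|g(W)f_z(W)|²) ≤ C/(1 + |g(z)|). -/

import Mathlib

open MeasureTheory ProbabilityTheory

/-- `G(x) = ∫₀ˣ g(t) dt`. -/
noncomputable def Gfun (g : ℝ → ℝ) (x : ℝ) : ℝ := ∫ t in (0:ℝ)..x, g t

/-- The density `p(x) = c₁ e^{-G(x)}`. -/
noncomputable def steinPDF (g : ℝ → ℝ) (c₁ x : ℝ) : ℝ := c₁ * Real.exp (-(Gfun g x))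

/-- The distribution function `F` with density `p`. -/
noncomputable def steinCDF (g : ℝ → ℝ) (c₁ z : ℝ) : ℝ := ∫ x in Set.Iic z, steinPDF g c₁ x

/-- The Stein solution `f_z`. -/
noncomputable def steinSol (g : ℝ → ℝ) (c₁ z x : ℝ) : ℝ :=
  if x ≤ z then steinCDF g c₁ x * (1 - steinCDF g c₁ z) / steinPDF g c₁ x
  else steinCDF g c₁ z * (1 - steinCDF g c₁ x) / steinPDF g c₁ x

/-- The derivative `f_z'` of the Stein solution, given by Stein's equation
`f_z'(x) = g(x) f_z(x) + I(x ≤ z) - F(z)`. -/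
noncomputable def steinSol' (g : ℝ → ℝ) (c₁ z x : ℝ) : ℝ :=
  g x * steinSol g c₁ z x + (if x ≤ z then 1 else 0) - steinCDF g c₁ z

section SteinEstimates

variable {g : ℝ → ℝ} {c : ℝ}

theorem steinPDF_pos (hc : 0 < c) (x : ℝ) : 0 < steinPDF g c x :=
  mul_pos hc (Real.exp_pos _)

theorem hasDerivAt_Gfun (hg : Continuous g) (x : ℝ) : HasDerivAt (Gfun g) (g x) x :=
  intervalIntegral.integral_hasDerivAt_right (hg.intervalIntegrable _ _)
    (hg.stronglyMeasurableAtFilter _ _) hg.continuousAt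

theorem hasDerivAt_steinPDF (hg : Continuous g) (x : ℝ) :
    HasDerivAt (steinPDF g c) (-(g x * steinPDF g c x)) x := by
  have h := ((hasDerivAt_Gfun hg x).neg.exp).const_mul c
  refine h.congr_deriv ?_
  simp only [steinPDF, Pi.neg_apply]
  ring

theorem continuous_steinPDF (hg : Continuous g) : Continuous (steinPDF g c) :=
  continuous_iff_continuousAt.2 fun x => (hasDerivAt_steinPDF hg x).continuousAt

theorem Gfun_neg_comp_neg (x : ℝ) : Gfun (fun t => -g (-t)) x = Gfun g (-x) := by
  simp only [Gfun, intervalIntegral.integral_neg]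
  rw [intervalIntegral.integral_comp_neg (fun t => g t), neg_zero,
    intervalIntegral.integral_symm, neg_neg]

theorem steinPDF_neg_comp_neg (x : ℝ) :
    steinPDF (fun t => -g (-t)) c x = steinPDF g c (-x) := by
  simp only [steinPDF, Gfun_neg_comp_neg]

theorem steinPDF_anti (hg : Continuous g) (hm : Monotone g) (h0 : g 0 = 0) (hc : 0 < c)
    {x y : ℝ} (hx : 0 ≤ x) (hxy : x ≤ y) : steinPDF g c y ≤ steinPDF g c x := by
  refine antitoneOn_of_deriv_nonpos (convex_Ici 0) (continuous_steinPDF hg).continuousOn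
    (fun t _ => (hasDerivAt_steinPDF hg t).differentiableAt.differentiableWithinAt) ?_
    (Set.mem_Ici.2 hx) (Set.mem_Ici.2 (hx.trans hxy)) hxy
  intro t ht
  rw [interior_Ici] at ht
  rw [(hasDerivAt_steinPDF hg t).deriv]
  have : 0 ≤ g t := h0 ▸ hm (le_of_lt ht)
  have := mul_nonneg this (steinPDF_pos (g := g) hc t).le
  linarith

theorem steinPDF_mono (hg : Continuous g) (hm : Monotone g) (h0 : g 0 = 0) (hc : 0 < c)
    {x y : ℝ} (hy : y ≤ 0) (hxy : x ≤ y) : steinPDF g c x ≤ steinPDF g c y := by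
  have h := steinPDF_anti (g := fun t => -g (-t)) (c := c) (x := -y) (y := -x) (by fun_prop)
    (fun s t hst => neg_le_neg (hm (neg_le_neg hst))) (by simp [h0]) hc (by linarith)
    (by linarith)
  simpa [steinPDF_neg_comp_neg] using h

/-- Mills-ratio bound for the upper tail. -/
theorem mul_upper_tail_le (hg : Continuous g) (hm : Monotone g) (hc : 0 < c)
    (hi : Integrable (steinPDF g c)) (z : ℝ) :
    g z * ∫ x in Set.Ioi z, steinPDF g c x ≤ steinPDF g c z := by
  have hlim := (intervalIntegral_tendsto_integral_Ioi z hi.integrableOn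
    Filter.tendsto_id).const_mul (g z)
  refine le_of_tendsto hlim ?_
  filter_upwards [Filter.eventually_ge_atTop z] with T hT
  have hp := continuous_steinPDF (c := c) hg
  have hftc : ∫ x in z..T, g x * steinPDF g c x = steinPDF g c z - steinPDF g c T := by
    have h := intervalIntegral.integral_eq_sub_of_hasDerivAt (a := z) (b := T)
      (fun x _ => hasDerivAt_steinPDF (c := c) hg x)
      ((hg.mul hp).neg.intervalIntegrable _ _)
    rw [intervalIntegral.integral_neg] at h
    linarith
  have hle : ∫ x in z..T, g z * steinPDF g c x ≤ ∫ x in z..T, g x * steinPDF g c x :=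
    intervalIntegral.integral_mono_on hT ((hp.const_mul _).intervalIntegrable _ _)
      ((hg.mul hp).intervalIntegrable _ _) fun x hx =>
        mul_le_mul_of_nonneg_right (hm hx.1) (steinPDF_pos hc x).le
  rw [intervalIntegral.integral_const_mul] at hle
  have := steinPDF_pos (g := g) hc T
  simp only [id]
  linarith

theorem integrable_steinPDF_neg_comp_neg (hi : Integrable (steinPDF g c)) :
    Integrable (steinPDF (fun t => -g (-t)) c) := by
  rw [show steinPDF (fun t => -g (-t)) c = fun x => steinPDF g c (-x) from
    funext steinPDF_neg_comp_neg]
  exact hi.comp_neg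

/-- Mills-ratio bound for the lower tail. -/
theorem neg_mul_lower_tail_le (hg : Continuous g) (hm : Monotone g) (hc : 0 < c)
    (hi : Integrable (steinPDF g c)) (z : ℝ) :
    -g z * ∫ x in Set.Iic z, steinPDF g c x ≤ steinPDF g c z := by
  have h := mul_upper_tail_le (g := fun t => -g (-t)) (by fun_prop)
    (fun s t hst => neg_le_neg (hm (neg_le_neg hst))) hc
    (integrable_steinPDF_neg_comp_neg hi) (-z)
  simpa [steinPDF_neg_comp_neg, integral_comp_neg_Ioi] using h

/-- The ratio of lower tail to density does not exceed its value at `0` to the left of `0`. -/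
theorem lower_tail_mul_le (hg : Continuous g) (hm : Monotone g) (hc : 0 < c)
    (hi : Integrable (steinPDF g c)) (h1 : ∫ x, steinPDF g c x = 1) {a : ℝ} (ha : a ≤ 0) :
    (∫ x in Set.Iic a, steinPDF g c x) * steinPDF g c 0 ≤ steinPDF g c a := by
  have hpt : ∀ t ∈ Set.Iic a,
      steinPDF g c t * steinPDF g c 0 ≤ steinPDF g c a * steinPDF g c (t - a) := by
    intro t ht
    have hta : t - a ≤ 0 := sub_nonpos.2 ht
    have hsplit : Gfun g t = Gfun g a + ∫ s in (0:ℝ)..(t - a), g (s + a) := by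
      rw [intervalIntegral.integral_comp_add_right (fun s => g s), zero_add, sub_add_cancel]
      exact (intervalIntegral.integral_add_adjacent_intervals
        (hg.intervalIntegrable _ _) (hg.intervalIntegrable _ _)).symm
    have hle : Gfun g (t - a) ≤ ∫ s in (0:ℝ)..(t - a), g (s + a) := by
      rw [Gfun, intervalIntegral.integral_symm,
        intervalIntegral.integral_symm (f := fun s => g (s + a)), neg_le_neg_iff]
      refine intervalIntegral.integral_mono_on hta
        (Continuous.intervalIntegrable (by fun_prop) _ _) (hg.intervalIntegrable _ _) ?_
      intro s _
      exact hm (by linarith)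
    have hG0 : Gfun g 0 = 0 := by simp [Gfun]
    have hexp : Real.exp (-Gfun g t) ≤ Real.exp (-Gfun g a) * Real.exp (-Gfun g (t - a)) := by
      rw [← Real.exp_add]
      exact Real.exp_le_exp.2 (by linarith)
    simp only [steinPDF, hG0, neg_zero, Real.exp_zero, mul_one]
    nlinarith [mul_le_mul_of_nonneg_left hexp (mul_pos hc hc).le]
  have hshift : Integrable fun t => steinPDF g c (t - a) := hi.comp_sub_right a
  have hmono := setIntegral_mono_on (hi.mul_const (steinPDF g c 0)).integrableOn
    (hshift.const_mul (steinPDF g c a)).integrableOn measurableSet_Iic hpt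
  rw [integral_mul_const, integral_const_mul] at hmono
  have hle1 : ∫ t in Set.Iic a, steinPDF g c (t - a) ≤ 1 := by
    refine (setIntegral_le_integral hshift
      (Filter.Eventually.of_forall fun t => (steinPDF_pos hc _).le)).trans ?_
    rw [integral_sub_right_eq_self (fun t => steinPDF g c t), h1]
  nlinarith [steinPDF_pos (g := g) hc a]

theorem abs_right_mul_tails_le (hg : Continuous g) (hm : Monotone g) (h0 : g 0 = 0) (hc : 0 < c)
    (hi : Integrable (steinPDF g c)) (h1 : ∫ x, steinPDF g c x = 1) {a b : ℝ} (hab : a ≤ b) :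
    |g b| * ((∫ x in Set.Iic a, steinPDF g c x) * ∫ x in Set.Ioi b, steinPDF g c x) ≤
      min (steinPDF g c a) (steinPDF g c b) := by
  have hp := fun x => (steinPDF_pos (g := g) hc x).le
  have hL1 : ∫ x in Set.Iic a, steinPDF g c x ≤ 1 :=
    (setIntegral_le_integral hi (Filter.Eventually.of_forall hp)).trans h1.le
  have hU1 : ∫ x in Set.Ioi b, steinPDF g c x ≤ 1 :=
    (setIntegral_le_integral hi (Filter.Eventually.of_forall hp)).trans h1.le
  have hL0 : 0 ≤ ∫ x in Set.Iic a, steinPDF g c x := integral_nonneg hp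
  have hU0 : 0 ≤ ∫ x in Set.Ioi b, steinPDF g c x := integral_nonneg hp
  have hU := mul_upper_tail_le hg hm hc hi b
  have hL := neg_mul_lower_tail_le hg hm hc hi a
  have hq := lower_tail_mul_le hg hm hc hi h1 (a := a)
  set L := ∫ x in Set.Iic a, steinPDF g c x
  set U := ∫ x in Set.Ioi b, steinPDF g c x
  rcases le_total 0 b with hb | hb
  · have hgb : 0 ≤ g b := h0 ▸ hm hb
    rw [abs_of_nonneg hgb]
    have hLU : g b * (L * U) ≤ L * steinPDF g c b := by nlinarith
    refine hLU.trans (le_min ?_ (mul_le_of_le_one_left (hp b) hL1))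
    rcases le_total 0 a with ha | ha
    · exact (mul_le_of_le_one_left (hp b) hL1).trans (steinPDF_anti hg hm h0 hc ha hab)
    · exact (mul_le_mul_of_nonneg_left (steinPDF_anti hg hm h0 hc le_rfl hb) hL0).trans (hq ha)
  · have hgb : g b ≤ 0 := h0 ▸ hm hb
    have hga : g a ≤ g b := hm hab
    rw [abs_of_nonpos hgb]
    have hLU : -g b * (L * U) ≤ -g a * L :=
      mul_le_mul (neg_le_neg hga) (mul_le_of_le_one_right hL0 hU1) (mul_nonneg hL0 hU0)
        (by linarith)
    exact (hLU.trans hL).trans (le_min le_rfl (steinPDF_mono hg hm h0 hc hb hab))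

theorem abs_left_mul_tails_le (hg : Continuous g) (hm : Monotone g) (h0 : g 0 = 0) (hc : 0 < c)
    (hi : Integrable (steinPDF g c)) (h1 : ∫ x, steinPDF g c x = 1) {a b : ℝ} (hab : a ≤ b) :
    |g a| * ((∫ x in Set.Iic a, steinPDF g c x) * ∫ x in Set.Ioi b, steinPDF g c x) ≤
      min (steinPDF g c a) (steinPDF g c b) := by
  have h := abs_right_mul_tails_le (g := fun t => -g (-t)) (a := -b) (b := -a) (by fun_prop)
    (fun s t hst => neg_le_neg (hm (neg_le_neg hst))) (by simp [h0]) hc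
    (integrable_steinPDF_neg_comp_neg hi)
    (by simp only [steinPDF_neg_comp_neg]; rw [integral_neg_eq_self (steinPDF g c), h1])
    (neg_le_neg hab)
  simp only [steinPDF_neg_comp_neg, integral_comp_neg_Ioi, integral_comp_neg_Iic, neg_neg,
    abs_neg] at h
  rwa [mul_comm (∫ x in Set.Iic a, steinPDF g c x), min_comm]

theorem one_sub_steinCDF (hi : Integrable (steinPDF g c)) (h1 : ∫ x, steinPDF g c x = 1)
    (z : ℝ) : 1 - steinCDF g c z = ∫ x in Set.Ioi z, steinPDF g c x := by
  rw [← h1, steinCDF, ← intervalIntegral.integral_Iic_add_Ioi hi.integrableOn hi.integrableOn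
    (b := z)]
  ring

theorem steinSol_nonneg (hc : 0 < c) (hi : Integrable (steinPDF g c))
    (h1 : ∫ x, steinPDF g c x = 1) (z x : ℝ) : 0 ≤ steinSol g c z x := by
  have hp := fun x => (steinPDF_pos (g := g) hc x).le
  simp only [steinSol, one_sub_steinCDF hi h1]
  split_ifs <;>
  exact div_nonneg (mul_nonneg (integral_nonneg hp) (integral_nonneg hp)) (hp x)

theorem abs_mul_steinSol_le_one (hg : Continuous g) (hm : Monotone g) (h0 : g 0 = 0)
    (hc : 0 < c) (hi : Integrable (steinPDF g c)) (h1 : ∫ x, steinPDF g c x = 1) (z x : ℝ) :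
    |g x| * steinSol g c z x ≤ 1 ∧ |g z| * steinSol g c z x ≤ 1 := by
  simp only [steinSol, one_sub_steinCDF hi h1]
  split_ifs with h
  · simp only [mul_div_assoc', div_le_one (steinPDF_pos hc x)]
    exact ⟨(abs_left_mul_tails_le hg hm h0 hc hi h1 h).trans (min_le_left _ _),
      (abs_right_mul_tails_le hg hm h0 hc hi h1 h).trans (min_le_left _ _)⟩
  · have h := (not_le.1 h).le
    simp only [mul_div_assoc', div_le_one (steinPDF_pos hc x)]
    exact ⟨(abs_right_mul_tails_le hg hm h0 hc hi h1 h).trans (min_le_right _ _),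
      (abs_left_mul_tails_le hg hm h0 hc hi h1 h).trans (min_le_right _ _)⟩

theorem abs_mul_steinSol_le_div (hg : Continuous g) (hm : Monotone g) (h0 : g 0 = 0)
    (hc : 0 < c) (hi : Integrable (steinPDF g c)) (h1 : ∫ x, steinPDF g c x = 1) (z x : ℝ) :
    |g x * steinSol g c z x| ≤ (1 + |g x|) / (1 + |g z|) := by
  obtain ⟨hx, hz⟩ := abs_mul_steinSol_le_one hg hm h0 hc hi h1 z x
  rw [abs_mul, abs_of_nonneg (steinSol_nonneg hc hi h1 z x), le_div_iff₀ (by positivity)]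
  nlinarith [mul_le_mul_of_nonneg_left hz (abs_nonneg (g x))]

theorem eq_zero_of_continuous_of_mul_nonneg (hg : Continuous g) (hs : ∀ x, 0 ≤ x * g x) :
    g 0 = 0 := by
  refine le_antisymm ?_ ?_
  · refine le_of_tendsto (hg.continuousAt.continuousWithinAt (s := Set.Iio 0)) ?_
    filter_upwards [self_mem_nhdsWithin] with x hx
    exact nonpos_of_mul_nonneg_right (hs x) hx
  · refine ge_of_tendsto (hg.continuousAt.continuousWithinAt (s := Set.Ioi 0)) ?_
    filter_upwards [self_mem_nhdsWithin] with x hx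
    exact nonneg_of_mul_nonneg_right (hs x) hx

end SteinEstimates

/-- Key estimate: `√(E|g(W) f_z(W)|²) ≤ C/(1 + |g(z)|)` with `C` depending only on `τ`
(from (A4)) and the value `M` of `E g²(W)`. -/
theorem stmt10 (τ M : ℝ) (hτ : τ ∈ Set.Ioo (0:ℝ) 1) :
    ∃ C : ℝ, 0 < C ∧
      ∀ (Ω : Type) (_ : MeasurableSpace Ω) (μ : Measure Ω), IsProbabilityMeasure μ →
      ∀ (g : ℝ → ℝ) (c₁ Kτ : ℝ),
        -- (A1)
        Monotone g → (∀ x : ℝ, 0 ≤ x * g x) →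
        -- (A2)
        ContDiff ℝ 2 g → (∀ x : ℝ, 0 ≤ 2 * (deriv g x) ^ 2 - g x * deriv (deriv g) x) →
        -- normalization
        0 < c₁ → (∫ x : ℝ, steinPDF g c₁ x) = 1 →
        -- (A3)
        Filter.Tendsto (fun x => g x * steinPDF g c₁ x) Filter.atBot (nhds 0) →
        Filter.Tendsto (fun x => g x * steinPDF g c₁ x) Filter.atTop (nhds 0) →
        -- (A4) for the given `τ`
        0 < Kτ → (∀ x : ℝ, g x / g (τ * x) ≤ Kτ) →
      ∀ (W : Ω → ℝ), Measurable W →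
        Integrable (fun ω => (g (W ω)) ^ 2) μ → (∫ ω, (g (W ω)) ^ 2 ∂μ) = M →
      ∀ z : ℝ,
        Real.sqrt (∫ ω, |g (W ω) * steinSol g c₁ z (W ω)| ^ 2 ∂μ) ≤ C / (1 + |g z|) := by
  refine ⟨√(2 + 2 * |M|), by positivity, ?_⟩
  intro Ω _ μ _ g c Kτ hm hs hC2 _ hc h1 _ _ _ _ W _ hI hM z
  have hg := hC2.continuous
  have h0 := eq_zero_of_continuous_of_mul_nonneg hg hs
  have hi : Integrable (steinPDF g c) := by
    by_contra h
    simp [integral_undef h] at h1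
  rw [← Real.sqrt_sq (show 0 ≤ 1 + |g z| by positivity), ← Real.sqrt_div' _ (by positivity)]
  refine Real.sqrt_le_sqrt ?_
  calc ∫ ω, |g (W ω) * steinSol g c z (W ω)| ^ 2 ∂μ
      ≤ ∫ ω, (2 + 2 * g (W ω) ^ 2) / (1 + |g z|) ^ 2 ∂μ := by
        refine integral_mono_of_nonneg (Filter.Eventually.of_forall fun ω => by positivity)
          (((integrable_const 2).add (hI.const_mul 2)).div_const _)
          (Filter.Eventually.of_forall fun ω => ?_)
        refine (pow_le_pow_left₀ (abs_nonneg _)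
          (abs_mul_steinSol_le_div hg hm h0 hc hi h1 z (W ω)) 2).trans ?_
        rw [div_pow]
        refine div_le_div_of_nonneg_right ?_ (by positivity)
        nlinarith [sq_nonneg (1 - |g (W ω)|), sq_abs (g (W ω))]
    _ = (2 + 2 * M) / (1 + |g z|) ^ 2 := by
        rw [integral_div, integral_add (integrable_const 2) (hI.const_mul 2),
          integral_const_mul, hM]
        simp
    _ ≤ (2 + 2 * |M|) / (1 + |g z|) ^ 2 := by
        gcongr
        exact le_abs_self M
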